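/- Let P be an n×n symmetric positive definite matrix, ρ > 0, d̄ > 0, s_ρ ≥ 0, s_d ≥ 0, v̄ ∈ ℝ, let M_Δ be a symmetric (n_v+n_w)×(n_v+n_w) matrix, and let Ṽ be an m×(n+n_w+n_d) real matrix. Suppose −Ṽ^T Ṽ + blkdiag(s_ρ P, 0, s_d I) − Z^T M_Δ Z ⪰ 0 and v̄² − s_ρ ρ − s_d d̄² ≥ 0. Then for every ξ = (x, w, d) ∈ ℝ^{n+n_w+n_d} with x^T P x ≤ ρ, ‖d‖ ≤ d̄, and (Zξ)^T M_Δ (Zξ) ≥ 0, it holds that ‖Ṽξ‖² ≤ v̄². -/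

import Mathlib

open Matrix

/-- The block-diagonal matrix `blkdiag(Y₁, Y₂, Y₃)`. -/
def blkdiag3 {n n_w n_d : ℕ} (Y1 : Matrix (Fin n) (Fin n) ℝ)
    (Y2 : Matrix (Fin n_w) (Fin n_w) ℝ) (Y3 : Matrix (Fin n_d) (Fin n_d) ℝ) :
    Matrix (Fin n ⊕ (Fin n_w ⊕ Fin n_d)) (Fin n ⊕ (Fin n_w ⊕ Fin n_d)) ℝ :=
  fromBlocks Y1 0 0 (fromBlocks Y2 0 0 Y3)

/-- The quadratic form of a block-diagonal matrix is the sum of those of its blocks. -/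
theorem dotProduct_blkdiag3_mulVec {n n_w n_d : ℕ} (Y1 : Matrix (Fin n) (Fin n) ℝ)
    (Y2 : Matrix (Fin n_w) (Fin n_w) ℝ) (Y3 : Matrix (Fin n_d) (Fin n_d) ℝ)
    (x : Fin n → ℝ) (w : Fin n_w → ℝ) (d : Fin n_d → ℝ) :
    Sum.elim x (Sum.elim w d) ⬝ᵥ blkdiag3 Y1 Y2 Y3 *ᵥ Sum.elim x (Sum.elim w d) =
      x ⬝ᵥ Y1 *ᵥ x + (w ⬝ᵥ Y2 *ᵥ w + d ⬝ᵥ Y3 *ᵥ d) := by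
  simp [blkdiag3, fromBlocks_mulVec]

/-- The quadratic form of the congruence `Aᵀ * M * A` is that of `M` evaluated at `A *ᵥ v`. -/
theorem dotProduct_transpose_mul_mul_mulVec {ι κ : Type*} [Fintype ι] [Fintype κ]
    (A : Matrix κ ι ℝ) (M : Matrix κ κ ℝ) (v : ι → ℝ) :
    v ⬝ᵥ (Aᵀ * M * A) *ᵥ v = (A *ᵥ v) ⬝ᵥ M *ᵥ (A *ᵥ v) := by
  rw [Matrix.mul_assoc, ← mulVec_mulVec, ← mulVec_mulVec, dotProduct_mulVec, vecMul_transpose]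

/-- local-QC-validity LMI, Remark 2: the LMI implies the containment
`‖Ṽξ‖² ≤ v̄²` on the sublevel set; note `(Ṽξ) ⬝ᵥ (Ṽξ) = ‖Ṽξ‖²` for the Euclidean
norm. -/
theorem lmi_implies_local_containment
    {n n_w n_d n_v m : ℕ}
    (P : Matrix (Fin n) (Fin n) ℝ) (hP : P.PosDef) (hPsymm : P.IsSymm)
    (ρ dbar sρ sd vbar : ℝ) (hρ : 0 < ρ) (hdbar : 0 < dbar)
    (hsρ : 0 ≤ sρ) (hsd : 0 ≤ sd)
    (MΔ : Matrix (Fin n_v ⊕ Fin n_w) (Fin n_v ⊕ Fin n_w) ℝ) (hMΔ : MΔ.IsSymm)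
    (Z : Matrix (Fin n_v ⊕ Fin n_w) (Fin n ⊕ (Fin n_w ⊕ Fin n_d)) ℝ)
    (Vt : Matrix (Fin m) (Fin n ⊕ (Fin n_w ⊕ Fin n_d)) ℝ)
    (hLMI : (- Vtᵀ * Vt + blkdiag3 (sρ • P) 0 (sd • 1)
      - Zᵀ * MΔ * Z).PosSemidef)
    (hscalar : vbar ^ 2 - sρ * ρ - sd * dbar ^ 2 ≥ 0) :
    ∀ (x : Fin n → ℝ) (w : Fin n_w → ℝ) (d : EuclideanSpace ℝ (Fin n_d)),
      x ⬝ᵥ P *ᵥ x ≤ ρ → ‖d‖ ≤ dbar →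
      0 ≤ (Z *ᵥ Sum.elim x (Sum.elim w d)) ⬝ᵥ MΔ *ᵥ (Z *ᵥ Sum.elim x (Sum.elim w d)) →
      (Vt *ᵥ Sum.elim x (Sum.elim w d)) ⬝ᵥ (Vt *ᵥ Sum.elim x (Sum.elim w d)) ≤
        vbar ^ 2 := by
  intro x w d hx hd hZ
  have hquad := hLMI.dotProduct_mulVec_nonneg (Sum.elim x (Sum.elim w d))
  have hVt : Sum.elim x (Sum.elim w d) ⬝ᵥ (Vtᵀ * Vt) *ᵥ Sum.elim x (Sum.elim w d) =
      (Vt *ᵥ Sum.elim x (Sum.elim w d)) ⬝ᵥ (Vt *ᵥ Sum.elim x (Sum.elim w d)) := by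
    rw [← mulVec_mulVec, dotProduct_mulVec, vecMul_transpose]
  have hdd : d.ofLp ⬝ᵥ d.ofLp = ‖d‖ ^ 2 := by
    rw [EuclideanSpace.real_norm_sq_eq]
    simp [dotProduct, sq]
  rw [star_trivial, sub_mulVec, add_mulVec, dotProduct_sub, dotProduct_add, Matrix.neg_mul,
    neg_mulVec, dotProduct_neg, hVt, dotProduct_transpose_mul_mul_mulVec,
    dotProduct_blkdiag3_mulVec, smul_mulVec, smul_mulVec, dotProduct_smul, dotProduct_smul,
    zero_mulVec, dotProduct_zero, one_mulVec, hdd, smul_eq_mul, smul_eq_mul] at hquad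
  have hsx : sρ * (x ⬝ᵥ P *ᵥ x) ≤ sρ * ρ := by gcongr
  have hsd' : sd * ‖d‖ ^ 2 ≤ sd * dbar ^ 2 := by gcongr
  linarith
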